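/- arXiv:1308.6161 — 2 statements merged into one kernel-verified Lean document; each statement's English description precedes it below -/
import Mathlib

section
/- Arbitrarily small perturbations with order-one Hilbert transform and small tails: for every δ > 0 and γ > 0 there exist parameters h, d, ε > 0 such that χ = χ_{h,d,ε} satisfies simultaneously: (i) ∫_ℝ|χ| + ∫_ℝ|χ'| < δ; (ii) PV∫_ℝ χ(p)/p dp > 1; and (iii) for every u ∈ ℝ with |u| > 2h+d+ε, |∫_ℝ χ(p)/(u−p) dp| < γ/|u|. -/
open MeasureTheory Filter

/-- The piecewise-linear destabilizing perturbation `χ_{h,d,ε}`: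
`χ(p) = hp/ε` for `|p| ≤ ε`, `χ(p) = h·sgn(p)` for `ε ≤ |p| ≤ d+ε`,
`χ(p) = sgn(p)(h+d/2+ε/2) − p/2` for `d+ε ≤ |p| ≤ 2h+d+ε`, and `χ(p) = 0` beyond. -/
noncomputable def chi (h d ε : ℝ) (p : ℝ) : ℝ :=
  if |p| ≤ ε then h * p / ε
  else if |p| ≤ d + ε then h * Real.sign p
  else if |p| ≤ 2 * h + d + ε then Real.sign p * (h + d / 2 + ε / 2) - p / 2
  else 0

/-- `f` is locally absolutely continuous with (a.e.) derivative `f'`: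
`f'` is locally integrable and the fundamental theorem of calculus holds. -/
def LocAbsCont (f f' : ℝ → ℝ) : Prop :=
  (∀ a b : ℝ, IntervalIntegrable f' MeasureTheory.volume a b) ∧
  ∀ a b : ℝ, f b - f a = ∫ t in a..b, f' t

section

variable {h d ε : ℝ}

lemma chi_eq_abs (hh : 0 < h) (hd : 0 < d) (hε : 0 < ε) (p : ℝ) :
    chi h d ε p = h / (2 * ε) * (|p - -ε| - |p - ε|)
      - 1 / 4 * (|p - (d + ε)| - |p - (2 * h + d + ε)|)
      - 1 / 4 * (|p - -(2 * h + d + ε)| - |p - -(d + ε)|) := by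
  have hε0 : ε ≠ 0 := hε.ne'
  rcases lt_trichotomy p 0 with hp | rfl | hp
  · rw [abs_of_nonpos (by linarith : p - ε ≤ 0), abs_of_nonpos (by linarith : p - (d + ε) ≤ 0),
      abs_of_nonpos (by linarith : p - (2 * h + d + ε) ≤ 0)]
    simp only [chi, abs_of_neg hp, Real.sign_of_neg hp]
    split_ifs with h1 h2 h3
    · rw [abs_of_nonneg (by linarith : 0 ≤ p - -ε), abs_of_nonneg (by linarith : 0 ≤ p - -(d + ε)),
        abs_of_nonneg (by linarith : 0 ≤ p - -(2 * h + d + ε))]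
      field_simp; ring
    · rw [abs_of_nonpos (by linarith : p - -ε ≤ 0), abs_of_nonneg (by linarith : 0 ≤ p - -(d + ε)),
        abs_of_nonneg (by linarith : 0 ≤ p - -(2 * h + d + ε))]
      field_simp; ring
    · rw [abs_of_nonpos (by linarith : p - -ε ≤ 0), abs_of_nonpos (by linarith : p - -(d + ε) ≤ 0),
        abs_of_nonneg (by linarith : 0 ≤ p - -(2 * h + d + ε))]
      field_simp; ring
    · rw [abs_of_nonpos (by linarith : p - -ε ≤ 0), abs_of_nonpos (by linarith : p - -(d + ε) ≤ 0),
        abs_of_nonpos (by linarith : p - -(2 * h + d + ε) ≤ 0)]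
      field_simp; ring
  · have h0 : chi h d ε 0 = 0 := by simp [chi, hε.le]
    simp only [h0, zero_sub, neg_neg, abs_neg]
    ring
  · rw [abs_of_nonneg (by linarith : 0 ≤ p - -ε), abs_of_nonneg (by linarith : 0 ≤ p - -(d + ε)),
      abs_of_nonneg (by linarith : 0 ≤ p - -(2 * h + d + ε))]
    simp only [chi, abs_of_pos hp, Real.sign_of_pos hp]
    split_ifs with h1 h2 h3
    · rw [abs_of_nonpos (by linarith : p - ε ≤ 0), abs_of_nonpos (by linarith : p - (d + ε) ≤ 0),
        abs_of_nonpos (by linarith : p - (2 * h + d + ε) ≤ 0)]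
      field_simp; ring
    · rw [abs_of_nonneg (by linarith : 0 ≤ p - ε), abs_of_nonpos (by linarith : p - (d + ε) ≤ 0),
        abs_of_nonpos (by linarith : p - (2 * h + d + ε) ≤ 0)]
      field_simp; ring
    · rw [abs_of_nonneg (by linarith : 0 ≤ p - ε), abs_of_nonneg (by linarith : 0 ≤ p - (d + ε)),
        abs_of_nonpos (by linarith : p - (2 * h + d + ε) ≤ 0)]
      field_simp; ring
    · rw [abs_of_nonneg (by linarith : 0 ≤ p - ε), abs_of_nonneg (by linarith : 0 ≤ p - (d + ε)),
        abs_of_nonneg (by linarith : 0 ≤ p - (2 * h + d + ε))]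
      field_simp; ring

lemma continuous_chi (hh : 0 < h) (hd : 0 < d) (hε : 0 < ε) : Continuous (chi h d ε) := by
  rw [funext (chi_eq_abs hh hd hε)]
  fun_prop

lemma chi_neg (p : ℝ) : chi h d ε (-p) = -chi h d ε p := by
  simp only [chi, abs_neg, Real.sign_neg]
  split_ifs <;> ring

lemma chi_eq_zero (hh : 0 < h) (hd : 0 < d) {p : ℝ} (hp : 2 * h + d + ε < |p|) :
    chi h d ε p = 0 := by
  simp only [chi]
  rw [if_neg (by linarith), if_neg (by linarith), if_neg (by linarith)]

/-- On the positive half-line `χ` lies between `0` and each of its linear pieces. -/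
lemma chi_bounds_of_pos (hh : 0 < h) (hd : 0 < d) (hε : 0 < ε) {p : ℝ} (hp : 0 < p) :
    0 ≤ chi h d ε p ∧ chi h d ε p ≤ h ∧ chi h d ε p ≤ h / ε * p ∧
      (p ≤ 2 * h + d + ε → chi h d ε p ≤ (2 * h + d + ε - p) / 2) := by
  have hc : 0 < h / ε := by positivity
  have hce : h / ε * ε = h := by field_simp
  simp only [chi, abs_of_pos hp, Real.sign_of_pos hp, mul_div_right_comm]
  split_ifs with h1 h2 h3
  · refine ⟨by positivity, by nlinarith, le_rfl, fun _ => by nlinarith⟩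
  · refine ⟨by linarith, by linarith, by nlinarith, fun _ => by linarith⟩
  · refine ⟨by linarith, by linarith, by nlinarith, fun _ => by linarith⟩
  · refine ⟨le_rfl, hh.le, by positivity, fun _ => by linarith⟩

lemma abs_chi_bounds (hh : 0 < h) (hd : 0 < d) (hε : 0 < ε) (p : ℝ) :
    |chi h d ε p| ≤ h ∧ |chi h d ε p| ≤ h / ε * |p| ∧
      (|p| ≤ 2 * h + d + ε → |chi h d ε p| ≤ (2 * h + d + ε - |p|) / 2) := by
  rcases lt_trichotomy p 0 with hp | rfl | hp
  · obtain ⟨h0, h1⟩ := chi_bounds_of_pos hh hd hε (neg_pos.2 hp)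
    rw [← abs_neg, ← chi_neg, abs_of_nonneg h0, abs_of_neg hp]
    exact h1
  · have : chi h d ε 0 = 0 := by simp [chi, hε.le]
    rw [this]
    simp only [abs_zero]
    exact ⟨hh.le, by simp, fun _ => by linarith⟩
  · obtain ⟨h0, h1⟩ := chi_bounds_of_pos hh hd hε hp
    rw [abs_of_nonneg h0, abs_of_pos hp]
    exact h1

lemma chi_div_self_nonneg (hh : 0 < h) (hd : 0 < d) (hε : 0 < ε) (p : ℝ) :
    0 ≤ chi h d ε p / p := by
  rcases lt_trichotomy p 0 with hp | rfl | hp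
  · have := (chi_bounds_of_pos hh hd hε (neg_pos.2 hp)).1
    rw [← neg_div_neg_eq, ← chi_neg]
    exact div_nonneg this (by linarith)
  · simp
  · exact div_nonneg (chi_bounds_of_pos hh hd hε hp).1 hp.le

lemma chi_eq_of_mem_Ioc (hε : 0 < ε) {p : ℝ} (hp : p ∈ Set.Ioc ε (d + ε)) :
    chi h d ε p = h := by
  have hp0 : 0 < p := hε.trans hp.1
  simp only [chi, abs_of_pos hp0, Real.sign_of_pos hp0]
  rw [if_neg (by linarith [hp.1]), if_pos hp.2, mul_one]

end

lemma integrable_indicator_Icc_const (a b C : ℝ) :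
    Integrable ((Set.Icc a b).indicator fun _ => C) :=
  (integrable_indicator_iff measurableSet_Icc).2 (integrableOn_const (by simp))

lemma integral_indicator_Icc_const {a b : ℝ} (hab : a ≤ b) (C : ℝ) :
    ∫ x, (Set.Icc a b).indicator (fun _ => C) x = (b - a) * C := by
  rw [integral_indicator measurableSet_Icc, setIntegral_const]
  simp [hab]

lemma measurable_real_sign : Measurable Real.sign := by
  unfold Real.sign
  exact Measurable.ite measurableSet_Iio measurable_const
    (Measurable.ite measurableSet_Ioi measurable_const measurable_const)

lemma abs_real_sign_le_one (x : ℝ) : |Real.sign x| ≤ 1 := by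
  rcases Real.sign_apply_eq x with h | h | h <;> simp [h]

lemma intervalIntegrable_sign_sub (c a b : ℝ) :
    IntervalIntegrable (fun t => Real.sign (t - c)) volume a b := by
  refine (intervalIntegrable_const (c := (1 : ℝ))).mono_fun
    (measurable_real_sign.comp (measurable_id.sub_const c)).aestronglyMeasurable
    (.of_forall fun x => ?_)
  simpa using abs_real_sign_le_one (x - c)

lemma integral_sign_sub (c a b : ℝ) :
    ∫ t in a..b, Real.sign (t - c) = |b - c| - |a - c| := by
  refine integral_eq_of_hasDerivAt_off_countable (fun t => |t - c|) _
    (Set.countable_singleton c) (by fun_prop) (fun x hx => ?_) (intervalIntegrable_sign_sub c a b)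
  have hx : x ≠ c := hx.2
  rcases lt_or_gt_of_ne hx with hx | hx
  · rw [Real.sign_of_neg (by linarith)]
    exact (hasDerivAt_abs_neg (by linarith : x - c < 0)).comp_sub_const x c
  · rw [Real.sign_of_pos (by linarith)]
    exact (hasDerivAt_abs_pos (by linarith : 0 < x - c)).comp_sub_const x c

lemma locAbsCont_abs_sub (c : ℝ) :
    LocAbsCont (fun t => |t - c|) (fun t => Real.sign (t - c)) :=
  ⟨intervalIntegrable_sign_sub c, fun a b => (integral_sign_sub c a b).symm⟩

lemma LocAbsCont.sub {f f' g g' : ℝ → ℝ} (hf : LocAbsCont f f') (hg : LocAbsCont g g') :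
    LocAbsCont (fun t => f t - g t) (fun t => f' t - g' t) := by
  refine ⟨fun a b => (hf.1 a b).sub (hg.1 a b), fun a b => ?_⟩
  rw [intervalIntegral.integral_sub (hf.1 a b) (hg.1 a b), ← hf.2, ← hg.2]
  ring

lemma LocAbsCont.const_mul {f f' : ℝ → ℝ} (hf : LocAbsCont f f') (c : ℝ) :
    LocAbsCont (fun t => c * f t) (fun t => c * f' t) := by
  refine ⟨fun a b => (hf.1 a b).const_mul c, fun a b => ?_⟩
  rw [intervalIntegral.integral_const_mul, ← hf.2]
  ring

lemma abs_sign_sub_sub_sign_sub_le {a b : ℝ} (hab : a ≤ b) (p : ℝ) :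
    |Real.sign (p - a) - Real.sign (p - b)| ≤ (Set.Icc a b).indicator (fun _ => (2 : ℝ)) p := by
  by_cases hp : p ∈ Set.Icc a b
  · rw [Set.indicator_of_mem hp]
    exact (abs_sub _ _).trans (by linarith [abs_real_sign_le_one (p - a), abs_real_sign_le_one (p - b)])
  · rw [Set.indicator_of_notMem hp]
    rcases lt_or_ge p a with h | h
    · rw [Real.sign_of_neg (by linarith), Real.sign_of_neg (by linarith)]; simp
    · have : b < p := by by_contra! h'; exact hp ⟨h, h'⟩
      rw [Real.sign_of_pos (by linarith), Real.sign_of_pos (by linarith)]; simp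

lemma integrable_sign_sub_sub_sign_sub {a b : ℝ} (hab : a ≤ b) :
    Integrable fun p => Real.sign (p - a) - Real.sign (p - b) :=
  (integrable_indicator_Icc_const a b 2).mono'
    ((measurable_real_sign.comp (measurable_id.sub_const a)).sub
      (measurable_real_sign.comp (measurable_id.sub_const b))).aestronglyMeasurable
    (.of_forall (abs_sign_sub_sub_sign_sub_le hab))

section

variable {h d ε : ℝ}

/-- `χ` is absolutely continuous with total variation at most `4h`. -/
lemma exists_locAbsCont_chi (hh : 0 < h) (hd : 0 < d) (hε : 0 < ε) :
    ∃ χ' : ℝ → ℝ, LocAbsCont (chi h d ε) χ' ∧ Integrable χ' ∧ ∫ p, |χ' p| ≤ 4 * h := by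
  have e1 : -ε ≤ ε := by linarith
  have e2 : d + ε ≤ 2 * h + d + ε := by linarith
  have e3 : -(2 * h + d + ε) ≤ -(d + ε) := by linarith
  refine ⟨fun p => h / (2 * ε) * (Real.sign (p - -ε) - Real.sign (p - ε))
      - 1 / 4 * (Real.sign (p - (d + ε)) - Real.sign (p - (2 * h + d + ε)))
      - 1 / 4 * (Real.sign (p - -(2 * h + d + ε)) - Real.sign (p - -(d + ε))), ?_, ?_, ?_⟩
  · rw [funext (chi_eq_abs hh hd hε)]
    exact (((((locAbsCont_abs_sub _).sub (locAbsCont_abs_sub _)).const_mul _).sub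
      (((locAbsCont_abs_sub _).sub (locAbsCont_abs_sub _)).const_mul _)).sub
      (((locAbsCont_abs_sub _).sub (locAbsCont_abs_sub _)).const_mul _))
  · exact ((((integrable_sign_sub_sub_sign_sub e1).const_mul _).sub
      ((integrable_sign_sub_sub_sign_sub e2).const_mul _)).sub
      ((integrable_sign_sub_sub_sign_sub e3).const_mul _))
  · have i1 := (integrable_indicator_Icc_const (-ε) ε 2).const_mul (h / (2 * ε))
    have i2 := (integrable_indicator_Icc_const (d + ε) (2 * h + d + ε) 2).const_mul (1 / 4)
    have i3 := (integrable_indicator_Icc_const (-(2 * h + d + ε)) (-(d + ε)) 2).const_mul (1 / 4)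
    refine (integral_mono_of_nonneg (.of_forall fun _ => abs_nonneg _) ((i1.add i2).add i3)
      (.of_forall fun p => ?_)).trans_eq ?_
    · refine (abs_sub _ _).trans (add_le_add ((abs_sub _ _).trans (add_le_add ?_ ?_)) ?_) <;>
        rw [abs_mul, abs_of_pos (by positivity)]
      · exact mul_le_mul_of_nonneg_left (abs_sign_sub_sub_sign_sub_le e1 p) (by positivity)
      · exact mul_le_mul_of_nonneg_left (abs_sign_sub_sub_sign_sub_le e2 p) (by positivity)
      · exact mul_le_mul_of_nonneg_left (abs_sign_sub_sub_sign_sub_le e3 p) (by positivity)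
    · rw [integral_add' (i1.add i2) i3, integral_add' i1 i2, integral_const_mul,
        integral_const_mul, integral_const_mul, integral_indicator_Icc_const e1,
        integral_indicator_Icc_const e2, integral_indicator_Icc_const e3]
      field_simp
      ring

lemma abs_chi_le_indicator (hh : 0 < h) (hd : 0 < d) (hε : 0 < ε) (p : ℝ) :
    |chi h d ε p| ≤ (Set.Icc (-(2 * h + d + ε)) (2 * h + d + ε)).indicator (fun _ => h) p := by
  by_cases hp : p ∈ Set.Icc (-(2 * h + d + ε)) (2 * h + d + ε)
  · rw [Set.indicator_of_mem hp]
    exact (abs_chi_bounds hh hd hε p).1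
  · rw [Set.indicator_of_notMem hp, chi_eq_zero hh hd, abs_zero]
    rwa [Set.mem_Icc, ← abs_le, not_le] at hp

lemma integrable_chi (hh : 0 < h) (hd : 0 < d) (hε : 0 < ε) : Integrable (chi h d ε) :=
  (integrable_indicator_Icc_const _ _ h).mono' (continuous_chi hh hd hε).aestronglyMeasurable
    (.of_forall (abs_chi_le_indicator hh hd hε))

lemma integral_abs_chi_le (hh : 0 < h) (hd : 0 < d) (hε : 0 < ε) :
    ∫ p, |chi h d ε p| ≤ 2 * (2 * h + d + ε) * h := by
  refine (integral_mono_of_nonneg (.of_forall fun _ => abs_nonneg _)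
    (integrable_indicator_Icc_const _ _ h)
    (.of_forall (abs_chi_le_indicator hh hd hε))).trans_eq ?_
  rw [integral_indicator_Icc_const (by linarith)]
  ring

lemma integrable_chi_div_self (hh : 0 < h) (hd : 0 < d) (hε : 0 < ε) :
    Integrable fun p => chi h d ε p / p := by
  refine (integrable_indicator_Icc_const (-(2 * h + d + ε)) (2 * h + d + ε) (h / ε)).mono'
    ((continuous_chi hh hd hε).measurable.div measurable_id).aestronglyMeasurable
    (.of_forall fun p => ?_)
  by_cases hp : p ∈ Set.Icc (-(2 * h + d + ε)) (2 * h + d + ε)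
  · rw [Set.indicator_of_mem hp, Real.norm_eq_abs, abs_div]
    exact div_le_of_le_mul₀ (abs_nonneg _) (by positivity) (abs_chi_bounds hh hd hε p).2.1
  · rw [Set.indicator_of_notMem hp, chi_eq_zero hh hd, zero_div, norm_zero]
    rwa [Set.mem_Icc, ← abs_le, not_le] at hp

lemma tendsto_setIntegral_lt_abs {f : ℝ → ℝ} (hf : Integrable f) :
    Tendsto (fun η : ℝ => ∫ p in {p : ℝ | η < |p|}, f p)
      (nhdsWithin 0 (Set.Ioi 0)) (nhds (∫ p, f p)) := by
  have hcover : AECover volume (nhdsWithin (0 : ℝ) (Set.Ioi 0)) fun η => {p : ℝ | η < |p|} := by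
    refine ⟨?_, fun η => measurableSet_lt measurable_const continuous_abs.measurable⟩
    filter_upwards [Measure.ae_ne volume (0 : ℝ)] with p hp
    exact mem_nhdsWithin_of_mem_nhds (Iio_mem_nhds (abs_pos.2 hp))
  exact hcover.integral_tendsto_of_countably_generated hf

lemma mul_log_le_integral_chi_div_self (hh : 0 < h) (hd : 0 < d) (hε : 0 < ε) :
    h * Real.log ((d + ε) / ε) ≤ ∫ p, chi h d ε p / p := by
  refine le_trans (le_of_eq ?_) (setIntegral_le_integral (s := Set.Ioc ε (d + ε))
    (integrable_chi_div_self hh hd hε) (.of_forall (chi_div_self_nonneg hh hd hε)))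
  rw [setIntegral_congr_fun (g := fun p => h * p⁻¹) measurableSet_Ioc
    (fun p hp => by simp only [chi_eq_of_mem_Ioc hε hp, div_eq_mul_inv]),
    ← intervalIntegral.integral_of_le (by linarith), intervalIntegral.integral_const_mul,
    integral_inv_of_pos hε (by linarith)]

lemma abs_integral_chi_div_sub_le (hh : 0 < h) (hd : 0 < d) (hε : 0 < ε) {u : ℝ}
    (hu : 2 * h + d + ε < |u|) :
    |∫ p, chi h d ε p / (u - p)| ≤ 2 * (2 * h + d + ε) ^ 2 / |u| := by
  set R := 2 * h + d + ε with hR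
  have hu0 : 0 < |u| := by linarith
  have hbound : ∀ p, ‖chi h d ε p / (u - p)‖ ≤
      (Set.Icc (-R) R).indicator (fun _ => R / |u|) p := by
    intro p
    by_cases hp : p ∈ Set.Icc (-R) R
    · rw [Set.indicator_of_mem hp, Real.norm_eq_abs, abs_div]
      have hpR : |p| ≤ R := abs_le.2 hp
      obtain ⟨h1, -, h2⟩ := abs_chi_bounds hh hd hε p
      have h3 := abs_sub_abs_le_abs_sub u p
      have h4 : 0 < |u| - |p| := by linarith
      rw [div_le_div_iff₀ (by linarith) hu0]
      have h5 := h2 hpR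
      rw [← hR] at h5
      have h6 : |chi h d ε p| * |p| ≤ (|u| - |p|) / 2 * R :=
        mul_le_mul (by linarith) hpR (abs_nonneg _) (by linarith)
      have h7 : |chi h d ε p| * (|u| - |p|) ≤ R / 2 * (|u| - |p|) :=
        mul_le_mul_of_nonneg_right (by linarith) h4.le
      have h8 : R * (|u| - |p|) ≤ R * |u - p| := mul_le_mul_of_nonneg_left h3 (by linarith)
      linarith
    · rw [Set.indicator_of_notMem hp, chi_eq_zero hh hd, zero_div, norm_zero]
      rwa [Set.mem_Icc, ← abs_le, not_le] at hp
  refine (norm_integral_le_of_norm_le (integrable_indicator_Icc_const _ _ _)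
    (.of_forall hbound)).trans_eq ?_
  rw [integral_indicator_Icc_const (by linarith)]
  ring

end

/-- Arbitrarily `W^{1,1}`-small perturbations `χ` with order-one principal value
Hilbert transform at the origin and small tails. -/
theorem chi_small_with_order_one_hilbert_transform :
    ∀ δ γ : ℝ, 0 < δ → 0 < γ →
      ∃ h d ε : ℝ, 0 < h ∧ 0 < d ∧ 0 < ε ∧
        (∃ χ' : ℝ → ℝ, LocAbsCont (chi h d ε) χ' ∧
          Integrable (chi h d ε) ∧ Integrable χ' ∧
          (∫ p : ℝ, |chi h d ε p|) + (∫ p : ℝ, |χ' p|) < δ) ∧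
        (∃ L : ℝ,
          Tendsto (fun η : ℝ => ∫ p in {p : ℝ | η < |p|}, chi h d ε p / p)
            (nhdsWithin 0 (Set.Ioi 0)) (nhds L) ∧ 1 < L) ∧
        (∀ u : ℝ, 2 * h + d + ε < |u| →
          |∫ p : ℝ, chi h d ε p / (u - p)| < γ / |u|) := by
  intro δ γ hδ hγ
  obtain ⟨t, ht, ht1, htδ, htγ⟩ : ∃ t : ℝ, 0 < t ∧ t ≤ 1 ∧ t ≤ δ / 13 ∧ t ≤ γ / 33 :=
    ⟨min 1 (min (δ / 13) (γ / 33)), by positivity, min_le_left _ _,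
      (min_le_right _ _).trans (min_le_left _ _), (min_le_right _ _).trans (min_le_right _ _)⟩
  obtain ⟨ε, hε⟩ : ∃ ε, ε = t * Real.exp (-(1 / t)) := ⟨_, rfl⟩
  have hε0 : 0 < ε := by rw [hε]; positivity
  have hεt : ε ≤ t := by
    rw [hε]
    exact mul_le_of_le_one_right ht.le (Real.exp_le_one_iff.2 (neg_nonpos.2 (by positivity)))
  have hR : 2 * t + t + ε ≤ 4 * t := by linarith
  refine ⟨t, t, ε, ht, ht, hε0, ?_, ⟨_,
    tendsto_setIntegral_lt_abs (integrable_chi_div_self ht ht hε0), ?_⟩, fun u hu => ?_⟩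
  · obtain ⟨χ', h1, h2, h3⟩ := exists_locAbsCont_chi ht ht hε0
    refine ⟨χ', h1, integrable_chi ht ht hε0, h2, ?_⟩
    have h4 := integral_abs_chi_le ht ht hε0
    nlinarith
  · refine lt_of_lt_of_le ?_ (mul_log_le_integral_chi_div_self ht ht hε0)
    have hlog : 1 / t < Real.log ((t + ε) / ε) := by
      rw [Real.lt_log_iff_exp_lt (by positivity), lt_div_iff₀ hε0]
      have : Real.exp (1 / t) * ε = t := by
        rw [hε, mul_left_comm, ← Real.exp_add, add_neg_cancel, Real.exp_zero, mul_one]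
      linarith
    calc 1 = t * (1 / t) := by field_simp
      _ < _ := mul_lt_mul_of_pos_left hlog ht
  · refine (abs_integral_chi_div_sub_le ht ht hε0 hu).trans_lt ?_
    have hu0 : 0 < |u| := by linarith
    refine div_lt_div_of_pos_right ?_ hu0
    nlinarith
end

section
/- For symmetric equilibria, unstable roots of the dispersion relation are purely imaginary unless a specific integral vanishes: let g : ℝ → ℝ be integrable and odd, let k ≠ 0, and let u = u_R + iu_I ∈ ℂ with u_I ≠ 0 satisfy ε_g(k,u) = 0. If ∫_ℝ p·g(p) / ( ((u_R−p)² + u_I²)·((u_R+p)² + u_I²) ) dp ≠ 0, then u_R = 0; equivalently ω = ku is purely imaginary, so ω² is real. -/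
open MeasureTheory

/-- The Vlasov-Poisson dispersion function `ε_g(k,z) = 1 + (1/k²) ∫ g(p)/(z−p) dp`. -/
noncomputable def eps (g : ℝ → ℝ) (k : ℝ) (z : ℂ) : ℂ :=
  1 + (1 / (k : ℂ) ^ 2) * ∫ p : ℝ, (g p : ℂ) / (z - p)

theorem integrable_ofReal_div_sub {g : ℝ → ℝ} (hg : Integrable g) {z : ℂ} (hz : z.im ≠ 0) :
    Integrable fun p : ℝ => (g p : ℂ) / (z - p) := by
  have hne : ∀ p : ℝ, z - p ≠ 0 := fun p h => hz (by simpa using congrArg Complex.im h)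
  have hcont : Continuous fun p : ℝ => (z - p)⁻¹ :=
    (continuous_const.sub Complex.continuous_ofReal).inv₀ hne
  refine (hg.ofReal (𝕜 := ℂ)).mul_bdd (c := |z.im|⁻¹) hcont.aestronglyMeasurable
    (Filter.Eventually.of_forall fun p => ?_)
  rw [norm_inv]
  gcongr
  simpa using Complex.abs_im_le_norm (z - p)

theorem im_ofReal_div_sub (x y a p : ℝ) :
    ((a : ℂ) / ((x : ℂ) + (y : ℂ) * Complex.I - p)).im =
      -y * (a / ((x - p) ^ 2 + y ^ 2)) := by
  rw [Complex.div_im]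
  simp [Complex.normSq_apply, ← pow_two]
  ring

theorem integrable_div_sq_add_sq {g : ℝ → ℝ} (hg : Integrable g) (x : ℝ) {y : ℝ} (hy : y ≠ 0) :
    Integrable fun p : ℝ => g p / ((x - p) ^ 2 + y ^ 2) := by
  have h := ((integrable_ofReal_div_sub hg
    (z := (x : ℂ) + (y : ℂ) * Complex.I) (by simpa using hy)).im).const_mul (-y)⁻¹
  refine h.congr (Filter.Eventually.of_forall fun p => ?_)
  change (-y)⁻¹ * ((g p : ℂ) / ((x : ℂ) + (y : ℂ) * Complex.I - p)).im = _
  rw [im_ofReal_div_sub, inv_mul_cancel_left₀ (neg_ne_zero.mpr hy)]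

/-- The imaginary part of the dispersion relation at a root off the real axis. -/
theorem integral_div_sq_add_sq_eq_zero_of_eps_eq_zero {g : ℝ → ℝ} (hg : Integrable g)
    {k : ℝ} (hk : k ≠ 0) {x y : ℝ} (hy : y ≠ 0)
    (hroot : eps g k ((x : ℂ) + (y : ℂ) * Complex.I) = 0) :
    ∫ p : ℝ, g p / ((x - p) ^ 2 + y ^ 2) = 0 := by
  have hint := integrable_ofReal_div_sub hg
    (z := (x : ℂ) + (y : ℂ) * Complex.I) (by simpa using hy)
  have hkC : (k : ℂ) ^ 2 ≠ 0 := pow_ne_zero 2 (Complex.ofReal_ne_zero.mpr hk)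
  have hval : ∫ p : ℝ, (g p : ℂ) / ((x : ℂ) + (y : ℂ) * Complex.I - p) =
      ((-k ^ 2 : ℝ) : ℂ) := by
    rw [eps, one_div_mul_eq_div, add_comm] at hroot
    rw [(div_eq_iff hkC).mp (eq_neg_of_add_eq_zero_left hroot)]
    push_cast
    ring
  have him := Complex.imCLM.integral_comp_comm hint
  simp only [Complex.imCLM_apply, im_ofReal_div_sub] at him
  rw [hval, Complex.ofReal_im, integral_const_mul] at him
  exact (mul_eq_zero.mp him).resolve_left (neg_ne_zero.mpr hy)

/-- For symmetric equilibria (odd `g = f₀'`), unstable roots of the dispersion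
relation are purely imaginary unless a specific integral vanishes: if the integral is
nonzero then `u_R = 0`, so `ω = ku` is purely imaginary and `ω²` is real. -/
theorem symmetric_equilibrium_roots_purely_imaginary
    (g : ℝ → ℝ) (hg : Integrable g) (hodd : ∀ p, g (-p) = -g p)
    (k : ℝ) (hk : k ≠ 0) (uR uI : ℝ) (huI : uI ≠ 0)
    (hroot : eps g k ((uR : ℂ) + (uI : ℂ) * Complex.I) = 0)
    (hI : (∫ p : ℝ,
        p * g p / (((uR - p) ^ 2 + uI ^ 2) * ((uR + p) ^ 2 + uI ^ 2))) ≠ 0) :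
    uR = 0 ∧ (((k : ℂ) * ((uR : ℂ) + (uI : ℂ) * Complex.I)) ^ 2).im = 0 := by
  have hminus := integral_div_sq_add_sq_eq_zero_of_eps_eq_zero hg hk huI hroot
  have hreflect : ∀ p, g (-p) / ((uR - -p) ^ 2 + uI ^ 2) =
      -(g p / ((uR + p) ^ 2 + uI ^ 2)) := fun p => by
    rw [hodd, sub_neg_eq_add, neg_div]
  have hplus : ∫ p : ℝ, g p / ((uR + p) ^ 2 + uI ^ 2) = 0 := by
    have h := integral_neg_eq_self (fun p : ℝ => g p / ((uR - p) ^ 2 + uI ^ 2)) volume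
    simp only [hreflect] at h
    rwa [integral_neg, hminus, neg_eq_zero] at h
  have hintm := integrable_div_sq_add_sq hg uR huI
  have hintp : Integrable fun p : ℝ => g p / ((uR + p) ^ 2 + uI ^ 2) := by
    have h := hintm.comp_neg.neg
    refine h.congr (Filter.Eventually.of_forall fun p => ?_)
    simp only [Pi.neg_apply, hreflect, neg_neg]
  have hdiff : ∀ p, g p / ((uR - p) ^ 2 + uI ^ 2) - g p / ((uR + p) ^ 2 + uI ^ 2) =
      4 * uR * (p * g p / (((uR - p) ^ 2 + uI ^ 2) * ((uR + p) ^ 2 + uI ^ 2))) := fun p => by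
    have hA : (uR - p) ^ 2 + uI ^ 2 ≠ 0 := by positivity
    have hB : (uR + p) ^ 2 + uI ^ 2 ≠ 0 := by positivity
    field_simp
    ring
  have hzero := integral_sub hintm hintp
  simp only [hdiff] at hzero
  rw [integral_const_mul, hminus, hplus, sub_zero] at hzero
  have huR : uR = 0 := by simpa [hI] using hzero
  refine ⟨huR, ?_⟩
  simp [huR, pow_two]
end
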